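/- For any two Hermitian complex N×N matrices ρ and σ, the ℓ1 distance between their ascending ordered spectra is bounded by twice the trace distance of the matrices: ∑_{i=1}^N |λ_i^↑(ρ) − λ_i^↑(σ)| ≤ ∑_{i=1}^N |λ_i^↑(ρ−σ)|. -/

import Mathlib

open Matrix
open scoped ComplexOrder
open Classical in
/-- The eigenvalues of a (Hermitian) matrix, listed in ascending order with
multiplicity; junk value `0` for non-Hermitian matrices. -/
noncomputable def eigAsc {N : ℕ} (A : Matrix (Fin N) (Fin N) ℂ) : Fin N → ℝ :=
  if h : A.IsHermitian then fun i => h.eigenvalues (Tuple.sort h.eigenvalues i)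
  else fun _ => 0

/-- The trace distance `‖A‖ = (1/2) ∑ᵢ |λᵢ^↑(A)|` (applied to `A = ρ - σ`). -/
noncomputable def trDist {N : ℕ} (A : Matrix (Fin N) (Fin N) ℂ) : ℝ :=
  (1 / 2) * ∑ i, |eigAsc A i|

/-- A density matrix: positive semidefinite with trace 1. -/
def IsDensity {N : ℕ} (ρ : Matrix (Fin N) (Fin N) ℂ) : Prop :=
  ρ.PosSemidef ∧ ρ.trace = 1

lemma aux_quad {N : ℕ} (T : EuclideanSpace ℂ (Fin N) →ₗ[ℂ] EuclideanSpace ℂ (Fin N))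
    (hT : T.IsSymmetric) (b : OrthonormalBasis (Fin N) ℂ (EuclideanSpace ℂ (Fin N)))
    (l : Fin N → ℝ) (hb : ∀ j, T (b j) = (l j : ℂ) • b j) (x : EuclideanSpace ℂ (Fin N)) :
    (inner ℂ x (T x)).re = ∑ j, l j * ‖inner ℂ (b j) x‖ ^ 2 := by
  rw [← b.sum_inner_mul_inner x (T x), Complex.re_sum]
  refine Finset.sum_congr rfl fun j _ => ?_
  have h1 : inner ℂ (b j) (T x) = (l j : ℂ) * inner ℂ (b j) x := by
    rw [← hT (b j) x, hb, inner_smul_left]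
    simp
  have h2 : inner ℂ x (b j) * inner ℂ (b j) x = ((‖inner ℂ (b j) x‖ ^ 2 : ℝ) : ℂ) := by
    rw [← inner_conj_symm x (b j), Complex.conj_mul']
    push_cast
    rfl
  rw [h1, mul_left_comm, h2, ← Complex.ofReal_mul, Complex.ofReal_re]

lemma aux_eigAsc_mono {N : ℕ} (A : Matrix (Fin N) (Fin N) ℂ) : Monotone (eigAsc A) := by
  unfold eigAsc
  split_ifs with h
  · exact Tuple.monotone_sort h.eigenvalues
  · exact monotone_const

lemma aux_eigAsc_basis {N : ℕ} (A : Matrix (Fin N) (Fin N) ℂ) (hA : A.IsHermitian) :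
    ∃ b : OrthonormalBasis (Fin N) ℂ (EuclideanSpace ℂ (Fin N)),
      ∀ j, A.toEuclideanLin (b j) = (eigAsc A j : ℂ) • b j := by
  refine ⟨hA.eigenvectorBasis.reindex (Tuple.sort hA.eigenvalues).symm, fun j => ?_⟩
  simp only [eigAsc, dif_pos hA, OrthonormalBasis.reindex_apply, Equiv.symm_symm]
  have := hA.mulVec_eigenvectorBasis (Tuple.sort hA.eigenvalues j)
  ext k
  have := congrFun this k
  simpa using this

lemma aux_sum {N : ℕ} (A : Matrix (Fin N) (Fin N) ℂ) (hA : A.IsHermitian) (g : ℝ → ℝ) :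
    ∑ i, g (eigAsc A i) = ∑ i, g (hA.eigenvalues i) := by
  simp only [eigAsc, dif_pos hA]
  exact Equiv.sum_comp (Tuple.sort hA.eigenvalues) fun i => g (hA.eigenvalues i)

lemma aux_trace {N : ℕ} (A : Matrix (Fin N) (Fin N) ℂ) (hA : A.IsHermitian) :
    ∑ i, eigAsc A i = A.trace.re := by
  rw [aux_sum A hA (fun x => x), hA.trace_eq_sum_eigenvalues]
  simp

/-- Weyl monotonicity. -/
lemma aux_weyl {N : ℕ} (A C : Matrix (Fin N) (Fin N) ℂ) (hA : A.IsHermitian)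
    (hC : C.IsHermitian) (h : (C - A).PosSemidef) (i : Fin N) : eigAsc A i ≤ eigAsc C i := by
  obtain ⟨u, hu⟩ := aux_eigAsc_basis A hA
  obtain ⟨v, hv⟩ := aux_eigAsc_basis C hC
  let f : EuclideanSpace ℂ (Fin N) →ₗ[ℂ] ({j : Fin N // j ≠ i} → ℂ) :=
    LinearMap.pi fun j => if j.1 < i then (innerSL ℂ (u j.1)).toLinearMap
      else (innerSL ℂ (v j.1)).toLinearMap
  have hf : LinearMap.ker f ≠ ⊥ := by
    apply LinearMap.ker_ne_bot_of_finrank_lt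
    have := i.pos
    simp
    omega
  obtain ⟨x, hx, hx0⟩ := Submodule.exists_mem_ne_zero_of_ne_bot hf
  have hfx : ∀ j (hj : j ≠ i), f x ⟨j, hj⟩ = 0 := by
    intro j hj
    rw [LinearMap.mem_ker.1 hx]; rfl
  have h1 : ∀ j, j < i → inner ℂ (u j) x = 0 := by
    intro j hj
    simpa [f, hj] using hfx j hj.ne
  have h2 : ∀ j, i < j → inner ℂ (v j) x = 0 := by
    intro j hj
    simpa [f, hj.not_gt] using hfx j hj.ne'
  have qA := aux_quad _ (isSymmetric_toEuclideanLin_iff.mpr hA) u _ hu x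
  have qC := aux_quad _ (isSymmetric_toEuclideanLin_iff.mpr hC) v _ hv x
  have hle : (inner ℂ x (A.toEuclideanLin x)).re ≤ (inner ℂ x (C.toEuclideanLin x)).re := by
    have := (isPositive_toEuclideanLin_iff.mpr h).re_inner_nonneg_right x
    rw [map_sub, LinearMap.sub_apply, inner_sub_right] at this
    simpa using this
  have lA : eigAsc A i * ‖x‖ ^ 2 ≤ (inner ℂ x (A.toEuclideanLin x)).re := by
    rw [qA, ← u.sum_sq_norm_inner_right x, Finset.mul_sum]
    refine Finset.sum_le_sum fun j _ => ?_
    rcases lt_or_ge j i with hj | hj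
    · simp [h1 j hj]
    · exact mul_le_mul_of_nonneg_right (aux_eigAsc_mono A hj) (by positivity)
  have lC : (inner ℂ x (C.toEuclideanLin x)).re ≤ eigAsc C i * ‖x‖ ^ 2 := by
    rw [qC, ← v.sum_sq_norm_inner_right x, Finset.mul_sum]
    refine Finset.sum_le_sum fun j _ => ?_
    rcases lt_or_ge i j with hj | hj
    · simp [h2 j hj]
    · exact mul_le_mul_of_nonneg_right (aux_eigAsc_mono C hj) (by positivity)
  have hpos : 0 < ‖x‖ ^ 2 := by positivity
  exact le_of_mul_le_mul_right (lA.trans (hle.trans lC)) hpos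

/-- Jordan decomposition. -/
lemma aux_jordan {N : ℕ} (A : Matrix (Fin N) (Fin N) ℂ) (hA : A.IsHermitian) :
    ∃ P Q : Matrix (Fin N) (Fin N) ℂ, P.PosSemidef ∧ Q.PosSemidef ∧ A = P - Q ∧
      P.trace.re + Q.trace.re = ∑ i, |eigAsc A i| := by
  let U : Matrix (Fin N) (Fin N) ℂ := hA.eigenvectorUnitary
  have hU : Uᴴ * U = 1 := Unitary.coe_star_mul_self hA.eigenvectorUnitary
  have tr : ∀ d : Fin N → ℝ, (U * diagonal (fun i => (d i : ℂ)) * Uᴴ).trace.re = ∑ i, d i := by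
    intro d
    rw [trace_mul_comm, ← mul_assoc, hU, one_mul, trace_diagonal]
    simp
  refine ⟨U * diagonal (fun i => ((max (hA.eigenvalues i) 0 : ℝ) : ℂ)) * Uᴴ,
    U * diagonal (fun i => ((max (-hA.eigenvalues i) 0 : ℝ) : ℂ)) * Uᴴ, ?_, ?_, ?_, ?_⟩
  · refine (PosSemidef.diagonal fun i => ?_).mul_mul_conjTranspose_same U
    exact Complex.zero_le_real.2 (le_max_right _ _)
  · refine (PosSemidef.diagonal fun i => ?_).mul_mul_conjTranspose_same U
    exact Complex.zero_le_real.2 (le_max_right _ _)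
  · rw [← sub_mul, ← mul_sub, diagonal_sub]
    conv_lhs => rw [hA.spectral_theorem, Unitary.conjStarAlgAut_apply]
    have : (fun i => ((max (hA.eigenvalues i) 0 : ℝ) : ℂ) - ((max (-hA.eigenvalues i) 0 : ℝ) : ℂ))
        = RCLike.ofReal ∘ hA.eigenvalues := by
      funext i
      rw [← Complex.ofReal_sub, max_zero_sub_eq_self]
      rfl
    rw [this]
    rfl
  · rw [tr, tr, aux_sum A hA (fun x => |x|), ← Finset.sum_add_distrib]
    refine Finset.sum_congr rfl fun i _ => ?_
    rcases le_total 0 (hA.eigenvalues i) with h | h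
    · rw [max_eq_left h, max_eq_right (by linarith), abs_of_nonneg h, add_zero]
    · rw [max_eq_right h, max_eq_left (by linarith), abs_of_nonpos h, zero_add]

/-- For Hermitian matrices ρ, σ, the ℓ1 distance of their ascending
ordered spectra is bounded by the ℓ1 norm of the spectrum of ρ - σ. -/
theorem stmt2 {N : ℕ} (ρ σ : Matrix (Fin N) (Fin N) ℂ)
    (hρ : ρ.IsHermitian) (hσ : σ.IsHermitian) :
    ∑ i, |eigAsc ρ i - eigAsc σ i| ≤ ∑ i, |eigAsc (ρ - σ) i| := by
  obtain ⟨P, Q, hP, hQ, hPQ, htr⟩ := aux_jordan (ρ - σ) (hρ.sub hσ)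
  have hC : (σ + P).IsHermitian := hσ.add hP.isHermitian
  have e : σ + P - ρ = Q := by
    have : ρ = P - Q + σ := by rw [← hPQ]; abel
    rw [this]; abel
  have w1 := aux_weyl σ (σ + P) hσ hC (by simpa using hP)
  have w2 := aux_weyl ρ (σ + P) hρ hC (by rw [e]; exact hQ)
  calc ∑ i, |eigAsc ρ i - eigAsc σ i|
      ≤ ∑ i, ((eigAsc (σ + P) i - eigAsc σ i) + (eigAsc (σ + P) i - eigAsc ρ i)) := by
        refine Finset.sum_le_sum fun i _ => ?_
        have := w1 i
        have := w2 i
        rw [abs_le]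
        constructor <;> linarith
    _ = P.trace.re + Q.trace.re := by
        rw [Finset.sum_add_distrib, Finset.sum_sub_distrib, Finset.sum_sub_distrib,
          aux_trace _ hC, aux_trace _ hσ, aux_trace _ hρ, ← e]
        simp only [trace_sub, trace_add, Complex.add_re, Complex.sub_re]
        ring
    _ = _ := htr
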